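/- arXiv:0912.2423 — 3 statements merged into one kernel-verified Lean document; each statement's English description precedes it below -/
import Mathlib

section
/- Let α ∈ (0,1), β ∈ (0, 1−α), c(α,β) = (2 ln(1 + 4(1−α−β)²))^{1/2} and ρ_D² = c(α,β) (Σ_{j=1}^D σ_j⁴)^{1/2}. Then for every ρ ≤ ρ_D, the infimum over all level-α tests Φ_α of sup_{θ ∈ S_D, ‖θ‖₂ = ρ} P_θ(Φ_α = 0) is at least β. In particular, the (α,β) minimax rate of testing over S_D with respect to the l₂ norm satisfies ρ₂(S_D, α, β) ≥ ρ_D. -/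
open MeasureTheory ProbabilityTheory ENNReal Finset

noncomputable section

/-- Distribution of the observation `Y = (Y_j)_{1 ≤ j ≤ N}` in the heteroscedastic Gaussian
sequence model `Y_j = θ_j + σ_j ε_j` (the coordinate `j : Fin N` represents the index `j+1`). -/
def gaussP (N : ℕ) (σ θ : Fin N → ℝ) : Measure (Fin N → ℝ) :=
  Measure.pi fun j => gaussianReal (θ j) (Real.toNNReal (σ j ^ 2))

/-- The `l₂` norm of a vector. -/
def l2norm (N : ℕ) (θ : Fin N → ℝ) : ℝ := Real.sqrt (∑ j, θ j ^ 2)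

/-- A level-`α` test of the null hypothesis `θ = 0`. -/
def IsLevelTest (N : ℕ) (σ : Fin N → ℝ) (α : ℝ) (Φ : (Fin N → ℝ) → Bool) : Prop :=
  Measurable Φ ∧ gaussP N σ 0 {y | Φ y = true} ≤ ENNReal.ofReal α

/-- Uniform separation rate of the test `Φ` over the class `F`, w.r.t. the `l₂` norm. -/
def sepRate (N : ℕ) (σ : Fin N → ℝ) (Φ : (Fin N → ℝ) → Bool) (F : Set (Fin N → ℝ))
    (β : ℝ) : ℝ≥0∞ :=
  sInf {ρ : ℝ≥0∞ | 0 < ρ ∧ ∀ θ ∈ F, ρ ≤ ENNReal.ofReal (l2norm N θ) →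
    ENNReal.ofReal (1 - β) < gaussP N σ θ {y | Φ y = true}}

/-- The `(α,β)` minimax rate of testing over the class `F`, w.r.t. the `l₂` norm. -/
def minimaxRate (N : ℕ) (σ : Fin N → ℝ) (F : Set (Fin N → ℝ)) (α β : ℝ) : ℝ≥0∞ :=
  sInf {r : ℝ≥0∞ | ∃ Φ : (Fin N → ℝ) → Bool, IsLevelTest N σ α Φ ∧ r = sepRate N σ Φ F β}

/-- Sum of `f j` over the (1-indexed) indices `1 ≤ j ≤ D`. -/
def lowSum (N D : ℕ) (f : Fin N → ℝ) : ℝ :=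
  ∑ j ∈ Finset.univ.filter (fun j : Fin N => (j : ℕ) < D), f j

/-- The set `S_D` of signals whose coefficients vanish after the (1-indexed) rank `D`. -/
def SD (N D : ℕ) : Set (Fin N → ℝ) := {θ | ∀ j : Fin N, D ≤ (j : ℕ) → θ j = 0}

/-- The product of the measures with densities `f i` has density `∏ i, f i`. -/
lemma pi_withDensity_ofReal {ι : Type*} [Fintype ι] (μ : ι → Measure ℝ)
    [∀ i, SigmaFinite (μ i)] (f : ι → ℝ → ℝ) (hf0 : ∀ i x, 0 ≤ f i x)
    (hf : ∀ i, Integrable (f i) (μ i)) :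
    Measure.pi (fun i => (μ i).withDensity fun x => ENNReal.ofReal (f i x)) =
      (Measure.pi μ).withDensity fun y => ENNReal.ofReal (∏ i, f i (y i)) := by
  refine Measure.pi_eq fun s hs => ?_
  rw [withDensity_apply _ (MeasurableSet.univ_pi hs), Measure.restrict_pi_pi,
    ← ofReal_integral_eq_lintegral_ofReal
      (Integrable.fintype_prod_dep fun i => (hf i).restrict)
      (ae_of_all _ fun y => prod_nonneg fun i _ => hf0 i _),
    integral_fintype_prod_eq_prod,
    ENNReal.ofReal_prod_of_nonneg fun i _ => integral_nonneg (hf0 i)]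
  refine prod_congr rfl fun i _ => ?_
  rw [withDensity_apply _ (hs i), ofReal_integral_eq_lintegral_ofReal (hf i).restrict
    (ae_of_all _ (hf0 i))]

/-- Likelihood ratio of `N(t v, v)` with respect to `N(0, v)`. -/
def gaussLR (v : NNReal) (t x : ℝ) : ℝ := Real.exp (t * x - v * t ^ 2 / 2)

lemma gaussLR_nonneg (v : NNReal) (t x : ℝ) : 0 ≤ gaussLR v t x := (Real.exp_pos _).le

lemma gaussLR_eq (v : NNReal) (t : ℝ) :
    gaussLR v t = fun x => Real.exp (t * x) * Real.exp (-(v * t ^ 2 / 2)) := by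
  funext x
  rw [gaussLR, ← Real.exp_add, sub_eq_add_neg]

lemma integrable_gaussLR (v : NNReal) (t : ℝ) : Integrable (gaussLR v t) (gaussianReal 0 v) := by
  rw [gaussLR_eq]
  exact (integrable_exp_mul_gaussianReal t).mul_const _

lemma integral_exp_mul_gaussianReal (v : NNReal) (t : ℝ) :
    ∫ x, Real.exp (t * x) ∂gaussianReal 0 v = Real.exp (v * t ^ 2 / 2) := by
  simpa [mgf] using congrFun (mgf_id_gaussianReal (μ := 0) (v := v)) t

lemma integral_gaussLR (v : NNReal) (t : ℝ) : ∫ x, gaussLR v t x ∂gaussianReal 0 v = 1 := by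
  rw [gaussLR_eq, integral_mul_const, integral_exp_mul_gaussianReal, ← Real.exp_add]
  simp

lemma gaussianReal_eq_withDensity_gaussLR {v : NNReal} (hv : v ≠ 0) (t : ℝ) :
    gaussianReal (t * v) v =
      (gaussianReal 0 v).withDensity fun x => ENNReal.ofReal (gaussLR v t x) := by
  have hm : Measurable (gaussLR v t) := by unfold gaussLR; fun_prop
  rw [gaussianReal_of_var_ne_zero _ hv, gaussianReal_of_var_ne_zero _ hv,
    ← withDensity_mul _ (measurable_gaussianPDF _ _) hm.ennreal_ofReal]
  congr 1
  funext x
  have hv' : (v : ℝ) ≠ 0 := by exact_mod_cast hv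
  simp only [Pi.mul_apply, gaussianPDF, gaussianPDFReal, gaussLR]
  rw [← ENNReal.ofReal_mul (by positivity), mul_assoc (√(2 * Real.pi * v))⁻¹, ← Real.exp_add]
  congr 3
  field_simp
  ring

/-- Likelihood ratio of the mixture `(N(t v, v) + N(-t v, v)) / 2` with respect to `N(0, v)`. -/
def symLR (v : NNReal) (t x : ℝ) : ℝ := (gaussLR v t x + gaussLR v (-t) x) / 2

lemma integrable_symLR (v : NNReal) (t : ℝ) : Integrable (symLR v t) (gaussianReal 0 v) :=
  ((integrable_gaussLR v t).add (integrable_gaussLR v (-t))).div_const 2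

lemma integral_symLR (v : NNReal) (t : ℝ) : ∫ x, symLR v t x ∂gaussianReal 0 v = 1 := by
  unfold symLR
  rw [integral_div, integral_add (integrable_gaussLR v t) (integrable_gaussLR v (-t)),
    integral_gaussLR, integral_gaussLR]
  norm_num

lemma symLR_sq (v : NNReal) (t : ℝ) :
    (fun x => symLR v t x ^ 2) = fun x =>
      (Real.exp (v * t ^ 2) * gaussLR v (2 * t) x + Real.exp (v * t ^ 2) * gaussLR v (2 * -t) x +
        2 * Real.exp (-(v * t ^ 2))) / 4 := by
  funext x
  have h (s : ℝ) : Real.exp (v * s ^ 2) * gaussLR v (2 * s) x = gaussLR v s x ^ 2 := by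
    rw [gaussLR, gaussLR, ← Real.exp_nat_mul, ← Real.exp_add]
    push_cast
    ring_nf
  have h' : gaussLR v t x * gaussLR v (-t) x = Real.exp (-(v * t ^ 2)) := by
    rw [gaussLR, gaussLR, ← Real.exp_add]
    ring_nf
  have h₁ := h (-t)
  rw [neg_sq] at h₁
  rw [h, h₁, ← h', symLR]
  ring

lemma integrable_symLR_sq (v : NNReal) (t : ℝ) :
    Integrable (fun x => symLR v t x ^ 2) (gaussianReal 0 v) := by
  rw [symLR_sq]
  exact ((((integrable_gaussLR _ _).const_mul _).add ((integrable_gaussLR _ _).const_mul _)).add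
    (integrable_const _)).div_const _

lemma integral_symLR_sq (v : NNReal) (t : ℝ) :
    ∫ x, symLR v t x ^ 2 ∂gaussianReal 0 v = Real.cosh (v * t ^ 2) := by
  have hi (s : ℝ) : Integrable (fun x => Real.exp (v * t ^ 2) * gaussLR v s x)
      (gaussianReal 0 v) := (integrable_gaussLR v s).const_mul _
  have hadd : Integrable (fun x => Real.exp (v * t ^ 2) * gaussLR v (2 * t) x +
      Real.exp (v * t ^ 2) * gaussLR v (2 * -t) x) (gaussianReal 0 v) := (hi _).add (hi _)
  rw [symLR_sq, integral_div, integral_add hadd (integrable_const _), integral_add (hi _) (hi _),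
    integral_const_mul, integral_const_mul, integral_gaussLR, integral_gaussLR, Real.cosh_eq]
  simp only [integral_const, probReal_univ, smul_eq_mul]
  ring

/-- A probability density whose chi-square divergence is at most `4 η²` increases the probability
of an event by at most `η`. -/
lemma setIntegral_le_of_integral_sq_le {Ω : Type*} [MeasurableSpace Ω] (P : Measure Ω)
    [IsProbabilityMeasure P] (L : Ω → ℝ) (hL : Integrable L P)
    (hL2 : Integrable (fun y => L y ^ 2) P) (h1 : ∫ y, L y ∂P = 1) (η : ℝ) (hη : 0 < η)
    (h2 : ∫ y, L y ^ 2 ∂P ≤ 1 + 4 * η ^ 2) {A : Set Ω} (hA : MeasurableSet A) :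
    ∫ y in A, L y ∂P ≤ P.real A + η := by
  have key (y : Ω) : A.indicator L y - A.indicator 1 y ≤
      (L y ^ 2 - 2 * L y + 1) / (8 * η) + η / 2 + (L y - 1) / 2 := by
    have hsq : 0 ≤ (L y - 1 - 2 * η) ^ 2 / (8 * η) := by positivity
    have hsq' : 0 ≤ (L y - 1 + 2 * η) ^ 2 / (8 * η) := by positivity
    have e : (L y - 1 - 2 * η) ^ 2 / (8 * η) =
        (L y ^ 2 - 2 * L y + 1) / (8 * η) + η / 2 - (L y - 1) / 2 := by field_simp; ring
    have e' : (L y - 1 + 2 * η) ^ 2 / (8 * η) =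
        (L y ^ 2 - 2 * L y + 1) / (8 * η) + η / 2 + (L y - 1) / 2 := by field_simp; ring
    by_cases hy : y ∈ A
    · simp only [hy, Set.indicator_of_mem, Pi.one_apply]
      linarith
    · simp only [hy, not_false_eq_true, Set.indicator_of_notMem]
      linarith
  have hi₁ : Integrable (A.indicator L) P := hL.indicator hA
  have hi₂ : Integrable (A.indicator (1 : Ω → ℝ)) P := (integrable_const (1 : ℝ)).indicator hA
  have hq : Integrable (fun y => L y ^ 2 - 2 * L y) P := hL2.sub (hL.const_mul 2)
  have hq' : Integrable (fun y => L y ^ 2 - 2 * L y + 1) P := hq.add (integrable_const 1)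
  have hl : Integrable (fun y => (L y - 1) / 2) P := (hL.sub (integrable_const 1)).div_const 2
  have hs : Integrable (fun y => (L y ^ 2 - 2 * L y + 1) / (8 * η) + η / 2) P :=
    (hq'.div_const _).add (integrable_const _)
  have h := integral_mono (hi₁.sub hi₂) (hs.add hl) key
  simp only [Pi.sub_apply, Pi.add_apply] at h
  rw [integral_sub hi₁ hi₂, integral_indicator hA, integral_indicator_one hA,
    integral_add hs hl, integral_add (hq'.div_const _) (integrable_const _),
    integral_div (8 * η), integral_add hq (integrable_const 1),
    integral_sub hL2 (hL.const_mul 2), integral_const_mul,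
    integral_div 2, integral_div 2, integral_sub hL (integrable_const 1), h1] at h
  simp only [integral_const, probReal_univ, smul_eq_mul] at h
  have hb : (∫ y, L y ^ 2 ∂P - 2 * 1 + 1 * 1) / (8 * η) ≤ η / 2 := by
    rw [div_le_iff₀ (by positivity)]
    nlinarith
  linarith

instance isProbabilityMeasure_gaussP (N : ℕ) (σ θ : Fin N → ℝ) :
    IsProbabilityMeasure (gaussP N σ θ) := by
  unfold gaussP
  infer_instance

/-- The sign in `{-1, 1}` encoded by a Boolean. -/
def boolSign (b : Bool) : ℝ := if b then 1 else -1

lemma boolSign_sq (b : Bool) : boolSign b ^ 2 = 1 := by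
  cases b <;> simp [boolSign]

lemma gaussP_real_eq (N : ℕ) (σ : Fin N → ℝ) (hσ : ∀ j, 0 < σ j) (t : Fin N → ℝ)
    {A : Set (Fin N → ℝ)} (hA : MeasurableSet A) :
    (gaussP N σ fun j => t j * σ j ^ 2).real A =
      ∫ y in A, ∏ j, gaussLR (Real.toNNReal (σ j ^ 2)) (t j) (y j) ∂gaussP N σ 0 := by
  have h : (gaussP N σ fun j => t j * σ j ^ 2) = (gaussP N σ 0).withDensity fun y =>
      ENNReal.ofReal (∏ j, gaussLR (Real.toNNReal (σ j ^ 2)) (t j) (y j)) := by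
    unfold gaussP
    simp only [Pi.zero_apply]
    rw [← pi_withDensity_ofReal _ _ (fun j => gaussLR_nonneg _ _)
      (fun j => integrable_gaussLR _ _)]
    congr 1
    funext j
    rw [← gaussianReal_eq_withDensity_gaussLR
      (Real.toNNReal_pos.2 (pow_pos (hσ j) 2)).ne', Real.coe_toNNReal _ (sq_nonneg _)]
  rw [Measure.real, h, withDensity_apply _ hA, integral_eq_lintegral_of_nonneg_ae
    (ae_of_all _ fun y => prod_nonneg fun j _ => gaussLR_nonneg _ _ _)]
  refine Measurable.aestronglyMeasurable ?_
  unfold gaussLR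
  fun_prop

/-- For every event there is a choice of signs for which the shifted Gaussian measure of the event
exceeds its null probability by at most `η`. -/
lemma exists_signs_gaussP_real_le (N : ℕ) (σ : Fin N → ℝ) (hσ : ∀ j, 0 < σ j) (t : Fin N → ℝ)
    (η : ℝ) (hη : 0 < η)
    (ht : Real.exp ((∑ j, t j ^ 4 * σ j ^ 4) / 2) ≤ 1 + 4 * η ^ 2)
    {A : Set (Fin N → ℝ)} (hA : MeasurableSet A) :
    ∃ ω : Fin N → Bool, (gaussP N σ fun j => boolSign (ω j) * t j * σ j ^ 2).real A ≤
      (gaussP N σ 0).real A + η := by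
  let v : Fin N → NNReal := fun j => Real.toNNReal (σ j ^ 2)
  let L : (Fin N → ℝ) → ℝ := fun y => ∏ j, symLR (v j) (t j) (y j)
  have hL : Integrable L (gaussP N σ 0) :=
    Integrable.fintype_prod_dep fun j => integrable_symLR (v j) (t j)
  have hLsq : (fun y => L y ^ 2) = fun y => ∏ j, symLR (v j) (t j) (y j) ^ 2 := by
    funext y
    exact (prod_pow _ _ _).symm
  have hL2 : Integrable (fun y => L y ^ 2) (gaussP N σ 0) := by
    rw [hLsq]
    exact Integrable.fintype_prod_dep fun j => integrable_symLR_sq (v j) (t j)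
  have h1 : ∫ y, L y ∂gaussP N σ 0 = 1 := by
    refine (integral_fintype_prod_eq_prod fun j => symLR (v j) (t j)).trans ?_
    exact prod_eq_one fun j _ => integral_symLR _ _
  have h2 : ∫ y, L y ^ 2 ∂gaussP N σ 0 ≤ 1 + 4 * η ^ 2 := by
    rw [hLsq]
    refine (integral_fintype_prod_eq_prod fun j x => symLR (v j) (t j) x ^ 2).trans_le ?_
    refine le_trans ?_ ht
    rw [sum_div, Real.exp_sum]
    refine prod_le_prod (fun j _ => integral_nonneg fun x => sq_nonneg _) fun j _ => ?_
    refine (integral_symLR_sq (v j) (t j)).trans_le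
      ((Real.cosh_le_exp_half_sq _).trans_eq ?_)
    rw [Real.coe_toNNReal _ (sq_nonneg _)]
    ring_nf
  have hbound := setIntegral_le_of_integral_sq_le _ L hL hL2 h1 η hη h2 hA
  have hmix : L = fun y => ∑ ω : Fin N → Bool,
      (1 / 2 : ℝ) ^ N * ∏ j, gaussLR (v j) (boolSign (ω j) * t j) (y j) := by
    funext y
    have e (j : Fin N) : symLR (v j) (t j) (y j) =
        ∑ b : Bool, 1 / 2 * gaussLR (v j) (boolSign b * t j) (y j) := by
      simp [symLR, boolSign]
      ring
    simp only [L, e]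
    rw [prod_univ_sum, Fintype.piFinset_univ]
    refine sum_congr rfl fun ω _ => ?_
    rw [prod_mul_distrib, prod_const, card_univ, Fintype.card_fin]
  have hint : ∫ y in A, L y ∂gaussP N σ 0 = ∑ ω : Fin N → Bool,
      (1 / 2 : ℝ) ^ N * (gaussP N σ fun j => boolSign (ω j) * t j * σ j ^ 2).real A := by
    rw [hmix, integral_finsetSum]
    · refine sum_congr rfl fun ω _ => ?_
      rw [integral_const_mul, gaussP_real_eq N σ hσ (fun j => boolSign (ω j) * t j) hA]
    · intro ω _
      exact (Integrable.const_mul (Integrable.fintype_prod_dep fun j =>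
        integrable_gaussLR (v j) (boolSign (ω j) * t j)) _).restrict
  have hone : ∑ _ω : Fin N → Bool, (1 / 2 : ℝ) ^ N * ((gaussP N σ 0).real A + η) =
      (gaussP N σ 0).real A + η := by
    simp
  rw [hint, ← hone] at hbound
  obtain ⟨ω, -, hω⟩ := exists_le_of_sum_le univ_nonempty hbound
  exact ⟨ω, le_of_mul_le_mul_left hω (by positivity)⟩

/-- A level-`α` test has a type II error of at least `β` at some signal of `S_D` of norm `ρ`,
for every `ρ ≤ ρ_D`. -/
lemma exists_gaussP_accept_ge (N D : ℕ) (hD : 1 ≤ D) (hDN : D ≤ N)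
    (σ : Fin N → ℝ) (hσ : ∀ j, 0 < σ j) (α β : ℝ) (hα0 : 0 < α) (hβ1 : β < 1 - α)
    (ρ : ℝ) (hρ0 : 0 ≤ ρ)
    (hρ : ρ ^ 2 ≤ Real.sqrt (2 * Real.log (1 + 4 * (1 - α - β) ^ 2)) *
      Real.sqrt (lowSum N D fun j => σ j ^ 4))
    (Φ : (Fin N → ℝ) → Bool) (hΦ : IsLevelTest N σ α Φ) :
    ∃ θ ∈ SD N D, l2norm N θ = ρ ∧ ENNReal.ofReal β ≤ gaussP N σ θ {y | Φ y = false} := by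
  set η := 1 - α - β
  have hη : 0 < η := by linarith
  set S := lowSum N D fun j => σ j ^ 4 with hS_def
  have hS : 0 < S := sum_pos (fun j _ => pow_pos (hσ j) 4)
    ⟨⟨0, by omega⟩, by simp; omega⟩
  let t : Fin N → ℝ := fun j => if (j : ℕ) < D then ρ / Real.sqrt S else 0
  have hpow (k : ℕ) (hk : k ≠ 0) :
      ∑ j, t j ^ k * σ j ^ 4 = (ρ / Real.sqrt S) ^ k * S := by
    simp only [hS_def, lowSum]
    rw [mul_sum, sum_filter]
    refine sum_congr rfl fun j _ => ?_
    by_cases hj : (j : ℕ) < D <;> simp [t, hj, hk, hS_def, lowSum]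
  have hss : Real.sqrt S ^ 2 = S := Real.sq_sqrt hS.le
  have ht : Real.exp ((∑ j, t j ^ 4 * σ j ^ 4) / 2) ≤ 1 + 4 * η ^ 2 := by
    have hlog : 0 ≤ Real.log (1 + 4 * η ^ 2) := Real.log_nonneg (by nlinarith [sq_nonneg η])
    rw [← Real.le_log_iff_exp_le (by positivity), hpow 4 (by norm_num)]
    have h4 : (ρ ^ 2) ^ 2 ≤ 2 * Real.log (1 + 4 * η ^ 2) * S := by
      refine (pow_le_pow_left₀ (sq_nonneg ρ) hρ 2).trans_eq ?_
      rw [mul_pow, hss, Real.sq_sqrt (by positivity)]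
    have e : (ρ / Real.sqrt S) ^ 4 * S = (ρ ^ 2) ^ 2 / S := by
      rw [div_pow, show Real.sqrt S ^ 4 = (Real.sqrt S ^ 2) ^ 2 by ring, hss]
      field_simp
    rw [e]
    have := (div_le_iff₀ hS).2 h4
    linarith
  have hA : MeasurableSet {y | Φ y = true} := hΦ.1 (measurableSet_singleton true)
  obtain ⟨ω, hω⟩ := exists_signs_gaussP_real_le N σ hσ t η hη ht hA
  refine ⟨fun j => boolSign (ω j) * t j * σ j ^ 2, ?_, ?_, ?_⟩
  · intro j hj
    simp [t, not_lt.2 hj]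
  · have e : ∑ j, (boolSign (ω j) * t j * σ j ^ 2) ^ 2 = ρ ^ 2 := by
      have e₁ (j : Fin N) : (boolSign (ω j) * t j * σ j ^ 2) ^ 2 = t j ^ 2 * σ j ^ 4 := by
        rw [mul_pow, mul_pow, boolSign_sq]
        ring
      simp only [e₁]
      rw [hpow 2 (by norm_num), div_pow, hss]
      field_simp
    rw [l2norm, e, Real.sqrt_sq hρ0]
  · have h0 : (gaussP N σ 0).real {y | Φ y = true} ≤ α :=
      ENNReal.toReal_le_of_le_ofReal hα0.le hΦ.2
    have hc : {y | Φ y = false} = {y | Φ y = true}ᶜ := by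
      ext y
      simp
    rw [hc, ENNReal.ofReal_le_iff_le_toReal (measure_ne_top _ _), ← Measure.real,
      probReal_compl_eq_one_sub hA]
    linarith

/-- Proposition 1: lower bound for the minimax rate of testing over `S_D` in the `l₂` norm. -/
theorem stmt0 (N D : ℕ) (hD : 1 ≤ D) (hDN : D ≤ N)
    (σ : Fin N → ℝ) (hσ : ∀ j, 0 < σ j)
    (α β : ℝ) (hα0 : 0 < α) (hα1 : α < 1) (hβ0 : 0 < β) (hβ1 : β < 1 - α)
    (ρD : ℝ) (hρD0 : 0 ≤ ρD)
    (hρD : ρD ^ 2 = Real.sqrt (2 * Real.log (1 + 4 * (1 - α - β) ^ 2)) *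
      Real.sqrt (lowSum N D fun j => σ j ^ 4))
    (ρ : ℝ) (hρ0 : 0 ≤ ρ) (hρ : ρ ≤ ρD) :
    (∀ Φ : (Fin N → ℝ) → Bool, IsLevelTest N σ α Φ →
      ENNReal.ofReal β ≤
        ⨆ θ : {θ : Fin N → ℝ // θ ∈ SD N D ∧ l2norm N θ = ρ},
          gaussP N σ θ.1 {y | Φ y = false}) ∧
    ENNReal.ofReal ρD ≤ minimaxRate N σ (SD N D) α β := by
  constructor
  · intro Φ hΦ
    obtain ⟨θ, hθ, hn, h⟩ := exists_gaussP_accept_ge N D hD hDN σ hσ α β hα0 hβ1 ρ hρ0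
      ((pow_le_pow_left₀ hρ0 hρ 2).trans_eq hρD) Φ hΦ
    exact h.trans (le_iSup (fun θ : {θ : Fin N → ℝ // θ ∈ SD N D ∧ l2norm N θ = ρ} =>
      gaussP N σ θ.1 {y | Φ y = false}) ⟨θ, hθ, hn⟩)
  · refine le_sInf ?_
    rintro _ ⟨Φ, hΦ, rfl⟩
    refine le_sInf ?_
    rintro r ⟨-, hr⟩
    by_contra! hlt
    obtain ⟨θ, hθ, hn, h⟩ := exists_gaussP_accept_ge N D hD hDN σ hσ α β hα0 hβ1 ρD hρD0
      hρD.le Φ hΦ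
    have hpow := hr θ hθ (by rw [hn]; exact hlt.le)
    have hA : MeasurableSet {y | Φ y = true} := hΦ.1 (measurableSet_singleton true)
    have hc : {y | Φ y = false} = {y | Φ y = true}ᶜ := by
      ext y
      simp
    rw [hc, ENNReal.ofReal_le_iff_le_toReal (measure_ne_top _ _), ← Measure.real,
      probReal_compl_eq_one_sub hA] at h
    rw [ENNReal.ofReal_lt_iff_lt_toReal (by linarith) (measure_ne_top _ _), ← Measure.real]
      at hpow
    linarith
end
end

section
/- Let α ∈ (0,1), β ∈ (0, 1−α) with α + β ≤ 0.59. Let σ_{(1)} ≤ σ_{(2)} ≤ … ≤ σ_{(n)} be the ordered standard deviations and define ρ_{n,∞} = max_{0 ≤ l ≤ n−1} σ_{(l+1)} √(ln(1 + n − l)). Then for every 1 ≤ k ≤ n, the (α,β) minimax rate of testing over S_{k,n} with respect to the l∞ norm satisfies ρ_∞(S_{k,n}, α, β) ≥ ρ_{n,∞}. -/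
open MeasureTheory ProbabilityTheory ENNReal Finset

noncomputable section

/-- The `l∞` norm of a vector. -/
def linfNorm (N : ℕ) (θ : Fin N → ℝ) : ℝ := ⨆ j : Fin N, |θ j|

/-- Uniform separation rate of the test `Φ` over the class `F`, w.r.t. the `l∞` norm. -/
def sepRateInf (N : ℕ) (σ : Fin N → ℝ) (Φ : (Fin N → ℝ) → Bool) (F : Set (Fin N → ℝ))
    (β : ℝ) : ℝ≥0∞ :=
  sInf {ρ : ℝ≥0∞ | 0 < ρ ∧ ∀ θ ∈ F, ρ ≤ ENNReal.ofReal (linfNorm N θ) →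
    ENNReal.ofReal (1 - β) < gaussP N σ θ {y | Φ y = true}}

/-- The `(α,β)` minimax rate of testing over the class `F`, w.r.t. the `l∞` norm. -/
def minimaxRateInf (N : ℕ) (σ : Fin N → ℝ) (F : Set (Fin N → ℝ)) (α β : ℝ) : ℝ≥0∞ :=
  sInf {r : ℝ≥0∞ | ∃ Φ : (Fin N → ℝ) → Bool, IsLevelTest N σ α Φ ∧
    r = sepRateInf N σ Φ F β}

/-- The set `S_{k,n}` of signals vanishing after the (1-indexed) rank `n` and having at most
`k` non-zero coefficients. -/
def Skn (N n k : ℕ) : Set (Fin N → ℝ) :=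
  {θ | (∀ j : Fin N, n ≤ (j : ℕ) → θ j = 0) ∧ {j : Fin N | θ j ≠ 0}.ncard ≤ k}

/-- Changing the mean of a centred Gaussian amounts to an exponential tilt. -/
lemma gaussianReal_eq_withDensity_exp (t : ℝ) {v : NNReal} (hv : v ≠ 0) :
    gaussianReal t v = (gaussianReal 0 v).withDensity
      (fun x => ENNReal.ofReal (Real.exp (t * x / v - t ^ 2 / (2 * v)))) := by
  have hv' : (v : ℝ) ≠ 0 := by exact_mod_cast hv
  rw [gaussianReal_of_var_ne_zero _ hv, gaussianReal_of_var_ne_zero _ hv,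
    ← withDensity_mul _ (by fun_prop) (by fun_prop)]
  congr 1
  ext x
  simp only [gaussianPDF, Pi.mul_apply]
  rw [← ENNReal.ofReal_mul (gaussianPDFReal_nonneg _ _ _)]
  congr 1
  simp only [gaussianPDFReal]
  rw [mul_assoc _ (Real.exp _) (Real.exp _), ← Real.exp_add]
  congr 2
  field_simp
  ring

/-- Reweighting one factor of a product of probability measures reweights the product. -/
lemma pi_update_withDensity {ι : Type*} [Fintype ι] [DecidableEq ι] {E : ι → Type*}
    [∀ i, MeasurableSpace (E i)] (μ : ∀ i, Measure (E i)) [∀ i, IsProbabilityMeasure (μ i)]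
    (j : ι) {f : E j → ℝ≥0∞} (hf : Measurable f) [IsProbabilityMeasure ((μ j).withDensity f)] :
    Measure.pi (Function.update μ j ((μ j).withDensity f)) =
      (Measure.pi μ).withDensity (fun y => f (y j)) := by
  have hprob : ∀ i, IsProbabilityMeasure (Function.update μ j ((μ j).withDensity f) i) := by
    intro i
    rcases eq_or_ne i j with rfl | hij
    · simpa using ‹IsProbabilityMeasure ((μ i).withDensity f)›
    · simpa [hij] using ‹∀ i, IsProbabilityMeasure (μ i)› i
  refine Measure.pi_eq fun s hs => ?_
  let h : ∀ i, E i → ℝ≥0∞ := fun i =>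
    (s i).indicator (Function.update (fun i (_ : E i) => (1 : ℝ≥0∞)) j f i)
  have hh : ∀ i, Measurable (h i) := by
    intro i
    refine Measurable.indicator ?_ (hs i)
    rcases eq_or_ne i j with rfl | hij
    · simpa using hf
    · simp [hij, measurable_const]
  have hpi : ∀ y : ∀ i, E i, ((Set.univ.pi s).indicator fun y => f (y j)) y = ∏ i, h i (y i) := by
    intro y
    by_cases hy : y ∈ Set.univ.pi s
    · rw [Set.indicator_of_mem hy, Finset.prod_eq_single j]
      · simp [h, hy j trivial]
      · intro i _ hij
        simp [h, hij, hy i trivial]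
      · simp
    · rw [Set.indicator_of_notMem hy]
      obtain ⟨i, hi⟩ : ∃ i, y i ∉ s i := by simpa [Set.mem_pi] using hy
      exact (Finset.prod_eq_zero (Finset.mem_univ i) (by simp [h, hi])).symm
  rw [withDensity_apply _ (MeasurableSet.univ_pi hs),
    ← lintegral_indicator (MeasurableSet.univ_pi hs), lintegral_congr hpi,
    lintegral_prod_eq_prod_lintegral_of_indepFun Finset.univ (fun i (y : ∀ i, E i) => h i (y i))
      (iIndepFun_pi fun i => (hh i).aemeasurable)
      (fun i => (hh i).comp (measurable_pi_apply i))]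
  refine Finset.prod_congr rfl fun i _ => ?_
  rw [(measurePreserving_eval μ i).lintegral_comp (hh i), lintegral_indicator (hs i)]
  rcases eq_or_ne i j with rfl | hij
  · simp [withDensity_apply _ (hs i)]
  · simp [hij]

/-- The relative density, minus one, of the equal mixture of `N(t, v)` and `N(-t, v)` with
respect to `N(0, v)`. -/
def mixDev (t v x : ℝ) : ℝ :=
  (Real.exp (t * x / v - t ^ 2 / (2 * v)) + Real.exp (-t * x / v - t ^ 2 / (2 * v))) / 2 - 1

lemma measurable_mixDev (t v : ℝ) : Measurable (mixDev t v) := by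
  unfold mixDev
  fun_prop

lemma integrable_exp_linear_gaussianReal (a b : ℝ) (v : NNReal) :
    Integrable (fun x => Real.exp (a * x + b)) (gaussianReal 0 v) := by
  simp_rw [Real.exp_add]
  exact (integrable_exp_mul_gaussianReal a).mul_const _

lemma integral_exp_linear_gaussianReal (a b : ℝ) (v : NNReal) :
    ∫ x, Real.exp (a * x + b) ∂gaussianReal 0 v = Real.exp (v * a ^ 2 / 2 + b) := by
  simp_rw [Real.exp_add]
  rw [integral_mul_const]
  congr 1
  simpa [mgf] using congrFun (mgf_id_gaussianReal (μ := 0) (v := v)) a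

lemma mixDev_eq (t v x : ℝ) : mixDev t v x =
    2⁻¹ * Real.exp (t / v * x + -(t ^ 2 / (2 * v))) +
      2⁻¹ * Real.exp (-(t / v) * x + -(t ^ 2 / (2 * v))) - 1 := by
  unfold mixDev
  ring_nf

lemma mixDev_sq_eq (t x : ℝ) {v : ℝ} (hv : v ≠ 0) : mixDev t v x ^ 2 =
    4⁻¹ * Real.exp (2 * t / v * x + -(t ^ 2 / v)) +
      4⁻¹ * Real.exp (-(2 * t / v) * x + -(t ^ 2 / v)) + 2⁻¹ * Real.exp (-(t ^ 2 / v)) -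
      Real.exp (t / v * x + -(t ^ 2 / (2 * v))) -
      Real.exp (-(t / v) * x + -(t ^ 2 / (2 * v))) + 1 := by
  have h1 : Real.exp (2 * t / v * x + -(t ^ 2 / v)) =
      Real.exp (t / v * x + -(t ^ 2 / (2 * v))) ^ 2 := by
    rw [← Real.exp_nat_mul]; congr 1; push_cast; field_simp
  have h2 : Real.exp (-(2 * t / v) * x + -(t ^ 2 / v)) =
      Real.exp (-(t / v) * x + -(t ^ 2 / (2 * v))) ^ 2 := by
    rw [← Real.exp_nat_mul]; congr 1; push_cast; field_simp
  have h3 : Real.exp (-(t ^ 2 / v)) = Real.exp (t / v * x + -(t ^ 2 / (2 * v))) *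
      Real.exp (-(t / v) * x + -(t ^ 2 / (2 * v))) := by
    rw [← Real.exp_add]; congr 1; field_simp; ring
  rw [mixDev_eq, h1, h2, h3]
  ring

lemma integral_mixDev (t : ℝ) {v : NNReal} (hv : v ≠ 0) :
    ∫ x, mixDev t v x ∂gaussianReal 0 v = 0 := by
  have hv' : (v : ℝ) ≠ 0 := by exact_mod_cast hv
  have hi := fun a b => integrable_exp_linear_gaussianReal a b v
  simp_rw [mixDev_eq]
  rw [integral_sub (by fun_prop) (by fun_prop), integral_add (by fun_prop) (by fun_prop)]
  simp only [integral_const_mul, integral_exp_linear_gaussianReal, integral_const]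
  have h1 : (v : ℝ) * (t / v) ^ 2 / 2 + -(t ^ 2 / (2 * v)) = 0 := by field_simp; ring
  simp [h1]
  norm_num

lemma integrable_mixDev_sq (t : ℝ) {v : NNReal} (hv : v ≠ 0) :
    Integrable (fun x => mixDev t v x ^ 2) (gaussianReal 0 v) := by
  have hv' : (v : ℝ) ≠ 0 := by exact_mod_cast hv
  have hi := fun a b => integrable_exp_linear_gaussianReal a b v
  simp_rw [mixDev_sq_eq t _ hv']
  fun_prop

lemma integral_mixDev_sq (t : ℝ) {v : NNReal} (hv : v ≠ 0) :
    ∫ x, mixDev t v x ^ 2 ∂gaussianReal 0 v = Real.cosh (t ^ 2 / v) - 1 := by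
  have hv' : (v : ℝ) ≠ 0 := by exact_mod_cast hv
  have hi := fun a b => integrable_exp_linear_gaussianReal a b v
  simp_rw [mixDev_sq_eq t _ hv']
  rw [integral_add (by fun_prop) (by fun_prop), integral_sub (by fun_prop) (by fun_prop),
    integral_sub (by fun_prop) (by fun_prop), integral_add (by fun_prop) (by fun_prop),
    integral_add (by fun_prop) (by fun_prop)]
  simp only [integral_const_mul, integral_exp_linear_gaussianReal, integral_const]
  have h1 : (v : ℝ) * (t / v) ^ 2 / 2 + -(t ^ 2 / (2 * v)) = 0 := by field_simp; ring
  have h2 : (v : ℝ) * (2 * t / v) ^ 2 / 2 + -(t ^ 2 / v) = t ^ 2 / v := by field_simp; ring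
  simp only [neg_sq, h1, h2, Real.exp_zero, Real.cosh_eq, probReal_univ, smul_eq_mul]
  ring

lemma integral_eval_gaussP {N : ℕ} (σ : Fin N → ℝ) (j : Fin N) {f : ℝ → ℝ} (hf : Measurable f) :
    ∫ y, f (y j) ∂gaussP N σ 0 = ∫ x, f x ∂gaussianReal 0 (Real.toNNReal (σ j ^ 2)) :=
  integral_comp_eval (X := fun _ : Fin N => ℝ) (i := j) hf.aestronglyMeasurable

lemma gaussP_single_eq_withDensity {N : ℕ} {σ : Fin N → ℝ} (j : Fin N) (hj : 0 < σ j) (t : ℝ) :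
    gaussP N σ (Pi.single j t) = (gaussP N σ 0).withDensity
      (fun y => ENNReal.ofReal (Real.exp (t * y j / σ j ^ 2 - t ^ 2 / (2 * σ j ^ 2)))) := by
  have hv : Real.toNNReal (σ j ^ 2) ≠ 0 := by simp [hj.ne']
  have hd := gaussianReal_eq_withDensity_exp t hv
  rw [Real.coe_toNNReal _ (sq_nonneg (σ j))] at hd
  have : IsProbabilityMeasure ((gaussianReal 0 (Real.toNNReal (σ j ^ 2))).withDensity
      (fun x => ENNReal.ofReal (Real.exp (t * x / σ j ^ 2 - t ^ 2 / (2 * σ j ^ 2))))) := by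
    rw [← hd]
    infer_instance
  unfold gaussP
  simp only [Pi.zero_apply]
  rw [← pi_update_withDensity (fun i => gaussianReal 0 (Real.toNNReal (σ i ^ 2))) j
    (f := fun x => ENNReal.ofReal (Real.exp (t * x / σ j ^ 2 - t ^ 2 / (2 * σ j ^ 2))))
    (by fun_prop), ← hd]
  congr 1
  ext1 i
  rcases eq_or_ne i j with rfl | hij
  · simp
  · simp [hij]

lemma integrable_likelihood {N : ℕ} (σ : Fin N → ℝ) (j : Fin N) (t : ℝ) :
    Integrable (fun y => Real.exp (t * y j / σ j ^ 2 - t ^ 2 / (2 * σ j ^ 2)))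
      (gaussP N σ 0) := by
  unfold gaussP
  refine integrable_comp_eval (X := fun _ : Fin N => ℝ) (i := j)
    (f := fun x => Real.exp (t * x / σ j ^ 2 - t ^ 2 / (2 * σ j ^ 2))) ?_
  refine (integrable_exp_linear_gaussianReal (t / σ j ^ 2) (-(t ^ 2 / (2 * σ j ^ 2))) _).congr ?_
  filter_upwards with x
  congr 1
  ring

lemma gaussP_single_real {N : ℕ} {σ : Fin N → ℝ} (j : Fin N) (hj : 0 < σ j) (t : ℝ)
    {A : Set (Fin N → ℝ)} (hA : MeasurableSet A) :
    (gaussP N σ (Pi.single j t)).real A =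
      ∫ y in A, Real.exp (t * y j / σ j ^ 2 - t ^ 2 / (2 * σ j ^ 2)) ∂gaussP N σ 0 := by
  rw [measureReal_def, gaussP_single_eq_withDensity j hj, withDensity_apply _ hA,
    integral_eq_lintegral_of_nonneg_ae (by filter_upwards with y; positivity)
      (Measurable.aestronglyMeasurable (by fun_prop))]

lemma gaussP_mixture_real {N : ℕ} {σ : Fin N → ℝ} (j : Fin N) (hj : 0 < σ j) (t : ℝ)
    {A : Set (Fin N → ℝ)} (hA : MeasurableSet A) :
    ((gaussP N σ (Pi.single j t)).real A + (gaussP N σ (Pi.single j (-t))).real A) / 2 -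
      (gaussP N σ 0).real A = ∫ y in A, mixDev t (σ j ^ 2) (y j) ∂gaussP N σ 0 := by
  have hi := fun t => (integrable_likelihood σ j t).integrableOn (s := A)
  have hi' := hi (-t)
  unfold mixDev
  rw [neg_sq] at hi'
  rw [gaussP_single_real j hj t hA, gaussP_single_real j hj (-t) hA, neg_sq,
    integral_sub ((Integrable.fun_add (hi t) hi').div_const 2) (integrable_const _), integral_div,
    integral_add (hi t) hi']
  simp

lemma memLp_mixDev (t s : ℝ) (hs : 0 < s) :
    MemLp (mixDev t (s ^ 2)) 2 (gaussianReal 0 (Real.toNNReal (s ^ 2))) := by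
  have hv : Real.toNNReal (s ^ 2) ≠ 0 := by simp [hs.ne']
  rw [memLp_two_iff_integrable_sq (measurable_mixDev _ _).aestronglyMeasurable]
  simpa [Real.coe_toNNReal _ (sq_nonneg s)] using integrable_mixDev_sq t hv

lemma memLp_sum_mixDev {N : ℕ} {σ : Fin N → ℝ} (hσ : ∀ j, 0 < σ j) (S : Finset (Fin N)) (t : ℝ) :
    MemLp (fun y => ∑ j ∈ S, mixDev t (σ j ^ 2) (y j)) 2 (gaussP N σ 0) :=
  memLp_finsetSum S fun j _ =>
    (memLp_mixDev t (σ j) (hσ j)).comp_measurePreserving (measurePreserving_eval _ j)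

lemma integral_sum_mixDev {N : ℕ} {σ : Fin N → ℝ} (hσ : ∀ j, 0 < σ j) (S : Finset (Fin N))
    (t : ℝ) : ∫ y, ∑ j ∈ S, mixDev t (σ j ^ 2) (y j) ∂gaussP N σ 0 = 0 := by
  have hone : ∀ j, ∫ y, mixDev t (σ j ^ 2) (y j) ∂gaussP N σ 0 = 0 := by
    intro j
    have hv : Real.toNNReal (σ j ^ 2) ≠ 0 := by simp [(hσ j).ne']
    rw [integral_eval_gaussP σ j (measurable_mixDev t (σ j ^ 2))]
    simpa [Real.coe_toNNReal _ (sq_nonneg (σ j))] using integral_mixDev t hv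
  rw [integral_finsetSum]
  · simp [hone]
  · intro j _
    exact ((memLp_mixDev t (σ j) (hσ j)).comp_measurePreserving
      (measurePreserving_eval _ j)).integrable (by norm_num)

lemma integral_sum_mixDev_sq {N : ℕ} {σ : Fin N → ℝ} (hσ : ∀ j, 0 < σ j) (S : Finset (Fin N))
    (t : ℝ) : ∫ y, (∑ j ∈ S, mixDev t (σ j ^ 2) (y j)) ^ 2 ∂gaussP N σ 0 =
      ∑ j ∈ S, (Real.cosh (t ^ 2 / σ j ^ 2) - 1) := by
  have hmem : ∀ j, MemLp (fun y : Fin N → ℝ => mixDev t (σ j ^ 2) (y j)) 2 (gaussP N σ 0) :=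
    fun j => (memLp_mixDev t (σ j) (hσ j)).comp_measurePreserving (measurePreserving_eval _ j)
  rw [← variance_of_integral_eq_zero (memLp_sum_mixDev hσ S t).aestronglyMeasurable.aemeasurable
    (integral_sum_mixDev hσ S t)]
  have hfun : (fun y : Fin N → ℝ => ∑ j ∈ S, mixDev t (σ j ^ 2) (y j)) =
      ∑ j ∈ S, fun y => mixDev t (σ j ^ 2) (y j) := by
    ext y
    simp
  rw [hfun, IndepFun.variance_sum (fun j _ => hmem j)]
  · refine Finset.sum_congr rfl fun j _ => ?_
    have hv : Real.toNNReal (σ j ^ 2) ≠ 0 := by simp [(hσ j).ne']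
    rw [variance_of_integral_eq_zero (hmem j).aestronglyMeasurable.aemeasurable
      (by simpa using integral_sum_mixDev hσ {j} t)]
    rw [integral_eval_gaussP σ j ((measurable_mixDev t (σ j ^ 2)).pow_const 2)]
    simpa [Real.coe_toNNReal _ (sq_nonneg (σ j))] using integral_mixDev_sq t hv
  · intro i _ j _ hij
    exact (iIndepFun_pi fun i => (measurable_mixDev t (σ i ^ 2)).aemeasurable).indepFun hij

/-- A centred variable has small integral over any event when its second moment is small. -/
lemma setIntegral_le_of_centered {Ω : Type*} [MeasurableSpace Ω] {P : Measure Ω}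
    [IsProbabilityMeasure P] {W : Ω → ℝ} (hW : MemLp W 2 P) (h0 : ∫ ω, W ω ∂P = 0)
    {A : Set Ω} (hA : MeasurableSet A) {m : ℝ} (hm : 0 < m) :
    ∫ ω in A, W ω ∂P ≤ (m + (∫ ω, W ω ^ 2 ∂P) / m) / 4 := by
  have hWi : Integrable W P := hW.integrable (by norm_num)
  have hrewrite : ∫ ω in A, W ω ∂P = ∫ ω, (A.indicator W ω - W ω / 2) ∂P := by
    rw [integral_sub (hWi.indicator hA) (hWi.div_const 2), integral_div, h0,
      integral_indicator hA]
    simp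
  have hbound : ∫ ω, (m + W ω ^ 2 / m) / 4 ∂P = (m + (∫ ω, W ω ^ 2 ∂P) / m) / 4 := by
    rw [integral_div, integral_add (integrable_const _) (hW.integrable_sq.div_const m),
      integral_div]
    simp
  rw [hrewrite, ← hbound]
  refine integral_mono ((hWi.indicator hA).sub (hWi.div_const 2))
    (((integrable_const _).add (hW.integrable_sq.div_const m)).div_const 4) fun ω => ?_
  have hsq : ∀ w : ℝ, w / 2 ≤ (m + w ^ 2 / m) / 4 := by
    intro w
    have h : (m + w ^ 2 / m) / 4 - w / 2 = (w - m) ^ 2 / (4 * m) := by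
      field_simp
      ring
    have : 0 ≤ (w - m) ^ 2 / (4 * m) := by positivity
    linarith
  by_cases hω : ω ∈ A
  · simp only [Set.indicator_of_mem hω]
    linarith [hsq (W ω)]
  · simp only [Set.indicator_of_notMem hω]
    have := hsq (-W ω)
    rw [neg_sq] at this
    linarith

lemma cosh_log_one_add_sub_one_le {m : ℝ} (hm : 0 < m) :
    Real.cosh (Real.log (1 + m)) - 1 ≤ m / 2 := by
  rw [Real.cosh_log (by linarith)]
  have : (1 + m + (1 + m)⁻¹) / 2 - 1 = m / 2 - m / (2 * (1 + m)) := by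
    field_simp
    ring
  rw [this]
  have : 0 ≤ m / (2 * (1 + m)) := by positivity
  linarith

/-- No event separates the null from all the one-sparse alternatives `± t e_j`, `j ∈ S`, when `t`
is at most `σ_j √(log (1 + |S|))` on `S`. -/
lemma exists_single_gaussP_real_le {N : ℕ} {σ : Fin N → ℝ} (hσ : ∀ j, 0 < σ j)
    {S : Finset (Fin N)} (hS : S.Nonempty) {t : ℝ}
    (ht : ∀ j ∈ S, t ^ 2 / σ j ^ 2 ≤ Real.log (1 + (S.card : ℝ)))
    {A : Set (Fin N → ℝ)} (hA : MeasurableSet A) :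
    ∃ j ∈ S, ∃ r : ℝ, |r| = |t| ∧
      (gaussP N σ (Pi.single j r)).real A ≤ (gaussP N σ 0).real A + 3 / 8 := by
  by_contra! hcon
  have hm : (0 : ℝ) < S.card := by exact_mod_cast hS.card_pos
  have hcosh : ∑ j ∈ S, (Real.cosh (t ^ 2 / σ j ^ 2) - 1) ≤ S.card * (S.card / 2) := by
    rw [← nsmul_eq_mul]
    refine Finset.sum_le_card_nsmul _ _ _ fun j hj => ?_
    refine le_trans ?_ (cosh_log_one_add_sub_one_le hm)
    have hle : Real.cosh (t ^ 2 / σ j ^ 2) ≤ Real.cosh (Real.log (1 + (S.card : ℝ))) :=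
      Real.cosh_le_cosh.2 (by
        rw [abs_of_nonneg (by positivity)]
        exact (ht j hj).trans (le_abs_self _))
    linarith
  have hupper := setIntegral_le_of_centered (memLp_sum_mixDev hσ S t) (integral_sum_mixDev hσ S t)
    hA hm
  rw [integral_sum_mixDev_sq hσ S t] at hupper
  have hdiv : (∑ j ∈ S, (Real.cosh (t ^ 2 / σ j ^ 2) - 1)) / S.card ≤ (S.card : ℝ) / 2 := by
    rw [div_le_iff₀ hm]
    linarith
  have hlower : (S.card : ℝ) * (3 / 8) <
      ∫ y in A, ∑ j ∈ S, mixDev t (σ j ^ 2) (y j) ∂gaussP N σ 0 := by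
    rw [integral_finsetSum, ← nsmul_eq_mul, ← Finset.sum_const]
    · refine Finset.sum_lt_sum_of_nonempty hS fun j hj => ?_
      rw [← gaussP_mixture_real j (hσ j) t hA]
      linarith [hcon j hj t rfl, hcon j hj (-t) (abs_neg t)]
    · intro j _
      exact (((memLp_mixDev t (σ j) (hσ j)).comp_measurePreserving
        (measurePreserving_eval _ j)).integrable (by norm_num)).integrableOn
  linarith

lemma linfNorm_single {N : ℕ} (j : Fin N) (t : ℝ) : linfNorm N (Pi.single j t) = |t| := by
  have : Nonempty (Fin N) := ⟨j⟩
  refine le_antisymm (ciSup_le fun i => ?_) ?_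
  · rcases eq_or_ne i j with rfl | hij
    · simp
    · simp [hij]
  · have := le_ciSup (f := fun i => |(Pi.single j t : Fin N → ℝ) i|) (Set.finite_range _).bddAbove j
    simpa [linfNorm] using this

lemma single_mem_Skn {N n k : ℕ} (hk : 1 ≤ k) {j : Fin N} (hj : (j : ℕ) < n) (t : ℝ) :
    (Pi.single j t : Fin N → ℝ) ∈ Skn N n k := by
  refine ⟨fun i hi => ?_, ?_⟩
  · rw [Pi.single_eq_of_ne]
    rintro rfl
    omega
  · refine le_trans ?_ hk
    rw [← Set.ncard_singleton j]
    refine Set.ncard_le_ncard (fun i hi => ?_) (Set.finite_singleton j)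
    by_contra hij
    rw [Set.mem_singleton_iff] at hij
    exact hi (by simp [hij])

/-- Corollary 1: lower bound for the minimax rate of sparse signal detection in the `l∞` norm. -/
theorem stmt2 (N n k : ℕ) (hk : 1 ≤ k) (hkn : k ≤ n) (hnN : n ≤ N)
    (σ : Fin N → ℝ) (hσ : ∀ j, 0 < σ j)
    (σs : ℕ → ℝ)
    (hperm : ∃ e : Equiv.Perm (Fin n), ∀ j : Fin n, σs (j : ℕ) = σ (Fin.castLE hnN (e j)))
    (hsmono : ∀ i j : ℕ, i ≤ j → j < n → σs i ≤ σs j)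
    (α β : ℝ) (hα0 : 0 < α) (hα1 : α < 1) (hβ0 : 0 < β) (hβ1 : β < 1 - α)
    (hαβ : α + β ≤ 0.59)
    (ρninf : ℝ)
    (hρninf : ρninf =
      (Finset.range n).sup' ⟨0, Finset.mem_range.mpr (lt_of_lt_of_le hk hkn)⟩
        fun l => σs l * Real.sqrt (Real.log (1 + ((n : ℝ) - l)))) :
    ENNReal.ofReal ρninf ≤ minimaxRateInf N σ (Skn N n k) α β := by
  obtain ⟨l, hl, hρ⟩ := Finset.exists_mem_eq_sup' (s := Finset.range n)
    ⟨0, Finset.mem_range.mpr (lt_of_lt_of_le hk hkn)⟩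
    (fun l : ℕ => σs l * Real.sqrt (Real.log (1 + ((n : ℝ) - l))))
  rw [← hρninf] at hρ
  have hln : l < n := Finset.mem_range.mp hl
  obtain ⟨e, he⟩ := hperm
  have hσs : 0 < σs l := by
    rw [he ⟨l, hln⟩]
    exact hσ _
  have hρ0 : 0 ≤ ρninf := by
    rw [hρ]
    positivity
  let S : Finset (Fin N) := (Finset.Ici (⟨l, hln⟩ : Fin n)).map
    (e.toEmbedding.trans (Fin.castLEEmb hnN))
  have hcard : S.card = n - l := by simp [S]
  have hS : S.Nonempty := by
    rw [← Finset.card_pos, hcard]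
    omega
  have hSmem : ∀ j ∈ S, (j : ℕ) < n ∧ σs l ≤ σ j := by
    intro j hj
    obtain ⟨i, hi, rfl⟩ := Finset.mem_map.mp hj
    have hli : l ≤ (i : ℕ) := by simpa [Fin.le_def] using hi
    refine ⟨(e i).isLt, ?_⟩
    have := hsmono l i hli i.isLt
    rwa [he i] at this
  have ht : ∀ j ∈ S, ρninf ^ 2 / σ j ^ 2 ≤ Real.log (1 + (S.card : ℝ)) := by
    intro j hj
    rw [hcard, Nat.cast_sub hln.le, hρ]
    have hlog : 0 ≤ Real.log (1 + ((n : ℝ) - l)) := by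
      apply Real.log_nonneg
      have : (l : ℝ) < n := by exact_mod_cast hln
      linarith
    rw [mul_pow, Real.sq_sqrt hlog, div_le_iff₀ (by have := hσ j; positivity), mul_comm]
    gcongr
    exact (hSmem j hj).2
  refine le_sInf ?_
  rintro _ ⟨Φ, ⟨hΦ, hlevel⟩, rfl⟩
  refine le_sInf ?_
  rintro ρ ⟨-, hpower⟩
  by_contra! hlt
  have hA : MeasurableSet {y | Φ y = true} := hΦ (measurableSet_singleton true)
  obtain ⟨j, hj, r, hr, hle⟩ := exists_single_gaussP_real_le hσ hS ht hA
  have hreject := hpower (Pi.single j r) (single_mem_Skn hk (hSmem j hj).1 r) (by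
    rw [linfNorm_single, hr, abs_of_nonneg hρ0]
    exact hlt.le)
  have h0 : (gaussP N σ 0).real {y | Φ y = true} ≤ α :=
    ENNReal.toReal_le_of_le_ofReal hα0.le hlevel
  have h1 : 1 - β < (gaussP N σ (Pi.single j r)).real {y | Φ y = true} :=
    (ENNReal.ofReal_lt_iff_lt_toReal (by linarith) (measure_ne_top _ _)).1 hreject
  norm_num at hαβ
  linarith
end
end

section
/- Let Y_j = θ_j + σ_j ε_j for 1 ≤ j ≤ D, where ε₁,…,ε_D are i.i.d. standard Gaussian random variables, θ_j ∈ ℝ and σ_j > 0. Set T̂ = Σ_{j=1}^D Y_j² and Σ = Σ_{j=1}^D σ_j⁴ + 2 Σ_{j=1}^D σ_j² θ_j². Then for every x ≥ 0: (i) P( T̂ − E[T̂] ≥ 2√(Σx) + 2 (max_{1≤j≤D} σ_j²) x ) ≤ exp(−x), and (ii) P( T̂ − E[T̂] ≤ −2√(Σx) ) ≤ exp(−x). -/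
open MeasureTheory ProbabilityTheory ENNReal Finset

noncomputable section

/-- The law of `(ε_1, …, ε_D)`, i.i.d. standard Gaussian random variables. -/
def stdGauss (D : ℕ) : Measure (Fin D → ℝ) := Measure.pi fun _ => gaussianReal 0 1

instance (D : ℕ) : IsProbabilityMeasure (stdGauss D) := by
  unfold stdGauss; infer_instance

/-- Completing the square in the exponent of `exp (t (a + s y)²)` against the Gaussian density. -/
lemma gaussianPDFReal_mul_exp_sq (a s t : ℝ) (ht : 0 < 1 - 2 * t * s ^ 2) (y : ℝ) :
    gaussianPDFReal 0 1 y * Real.exp (t * ((a + s * y) ^ 2 - (a ^ 2 + s ^ 2))) =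
      (√(2 * Real.pi))⁻¹ *
          Real.exp (2 * t ^ 2 * s ^ 2 * a ^ 2 / (1 - 2 * t * s ^ 2) - t * s ^ 2) *
        Real.exp (-((1 - 2 * t * s ^ 2) / 2) *
          (y - 2 * t * a * s / (1 - 2 * t * s ^ 2)) ^ 2) := by
  simp only [gaussianPDFReal, NNReal.coe_one, mul_one, sub_zero]
  rw [mul_assoc, mul_assoc, ← Real.exp_add, ← Real.exp_add]
  congr 2
  field_simp
  ring

lemma integrable_exp_sq_gaussianReal (a s t : ℝ) (ht : 0 < 1 - 2 * t * s ^ 2) :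
    Integrable (fun y => Real.exp (t * ((a + s * y) ^ 2 - (a ^ 2 + s ^ 2))))
      (gaussianReal 0 1) := by
  rw [gaussianReal_of_var_ne_zero _ one_ne_zero,
    integrable_withDensity_iff_integrable_smul₀' (measurable_gaussianPDF 0 1).aemeasurable
      (ae_of_all _ fun _ => gaussianPDF_lt_top)]
  simp only [toReal_gaussianPDF, smul_eq_mul, gaussianPDFReal_mul_exp_sq a s t ht]
  exact ((integrable_exp_neg_mul_sq (half_pos ht)).comp_sub_right _).const_mul _

lemma integral_exp_sq_gaussianReal (a s t : ℝ) (ht : 0 < 1 - 2 * t * s ^ 2) :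
    ∫ y, Real.exp (t * ((a + s * y) ^ 2 - (a ^ 2 + s ^ 2))) ∂(gaussianReal 0 1) =
      Real.exp (-Real.log (1 - 2 * t * s ^ 2) / 2 - t * s ^ 2 +
        2 * t ^ 2 * s ^ 2 * a ^ 2 / (1 - 2 * t * s ^ 2)) := by
  rw [integral_gaussianReal_eq_integral_smul one_ne_zero]
  simp only [smul_eq_mul, gaussianPDFReal_mul_exp_sq a s t ht]
  rw [integral_const_mul,
    integral_sub_right_eq_self (fun y => Real.exp (-((1 - 2 * t * s ^ 2) / 2) * y ^ 2)),
    integral_gaussian]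
  generalize hu : 1 - 2 * t * s ^ 2 = u at ht
  have hsqrt : √(Real.pi / (u / 2)) = √(2 * Real.pi) * Real.exp (-Real.log u / 2) := by
    have hexp : Real.exp (-Real.log u / 2) = √(u⁻¹) := by
      rw [Real.exp_half, Real.exp_neg, Real.exp_log ht]
    rw [hexp, ← Real.sqrt_mul (by positivity)]
    congr 1
    field_simp
  have hpi : √(2 * Real.pi) ≠ 0 := by positivity
  rw [hsqrt, mul_mul_mul_comm, inv_mul_cancel₀ hpi, one_mul, ← Real.exp_add]
  congr 1
  ring

lemma neg_log_le_of_le_one {u : ℝ} (hu : 0 < u) (hu1 : u ≤ 1) :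
    -Real.log u ≤ (u⁻¹ - u) / 2 := by
  have h : 0 ≤ Real.log u⁻¹ := Real.log_nonneg ((one_le_inv₀ hu).2 hu1)
  have := Real.self_le_sinh_iff.2 h
  rwa [Real.sinh_log (inv_pos.2 hu), Real.log_inv, inv_inv] at this

lemma neg_log_le_of_one_le {u : ℝ} (hu : 1 ≤ u) :
    -Real.log u ≤ (1 - u) + (1 - u) ^ 2 / 2 := by
  have h := Real.le_log_one_add_of_nonneg (sub_nonneg.2 hu)
  rw [add_sub_cancel] at h
  have h' : (u - 1) - (u - 1) ^ 2 / 2 ≤ 2 * (u - 1) / (u - 1 + 2) := by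
    rw [le_div_iff₀ (by linarith)]
    nlinarith [pow_nonneg (sub_nonneg.2 hu) 3]
  linarith

lemma integral_exp_sq_gaussianReal_le_of_nonneg {a s t κ : ℝ} (ht : 0 ≤ t) (hκ : 0 < κ)
    (hle : κ ≤ 1 - 2 * t * s ^ 2) :
    ∫ y, Real.exp (t * ((a + s * y) ^ 2 - (a ^ 2 + s ^ 2))) ∂(gaussianReal 0 1) ≤
      Real.exp (t ^ 2 / κ * (s ^ 4 + 2 * (s ^ 2 * a ^ 2))) := by
  have hu : 0 < 1 - 2 * t * s ^ 2 := hκ.trans_le hle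
  rw [integral_exp_sq_gaussianReal a s t hu, Real.exp_le_exp]
  have hlog := neg_log_le_of_le_one hu (by nlinarith [mul_nonneg ht (sq_nonneg s)])
  calc _ ≤ t ^ 2 / (1 - 2 * t * s ^ 2) * (s ^ 4 + 2 * (s ^ 2 * a ^ 2)) := by
        have : ((1 - 2 * t * s ^ 2)⁻¹ - (1 - 2 * t * s ^ 2)) / 2 / 2 - t * s ^ 2 +
            2 * t ^ 2 * s ^ 2 * a ^ 2 / (1 - 2 * t * s ^ 2) =
            t ^ 2 / (1 - 2 * t * s ^ 2) * (s ^ 4 + 2 * (s ^ 2 * a ^ 2)) := by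
          field_simp
          ring
        linarith
    _ ≤ _ := by gcongr

lemma integral_exp_sq_gaussianReal_le_of_nonpos {a s t : ℝ} (ht : t ≤ 0) :
    ∫ y, Real.exp (t * ((a + s * y) ^ 2 - (a ^ 2 + s ^ 2))) ∂(gaussianReal 0 1) ≤
      Real.exp (t ^ 2 * (s ^ 4 + 2 * (s ^ 2 * a ^ 2))) := by
  have hu : 1 ≤ 1 - 2 * t * s ^ 2 := by
    nlinarith [mul_nonneg (neg_nonneg.2 ht) (sq_nonneg s)]
  rw [integral_exp_sq_gaussianReal a s t (by linarith), Real.exp_le_exp]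
  have hlog := neg_log_le_of_one_le hu
  have hdiv : 2 * t ^ 2 * s ^ 2 * a ^ 2 / (1 - 2 * t * s ^ 2) ≤ 2 * t ^ 2 * s ^ 2 * a ^ 2 :=
    div_le_self (by positivity) hu
  linarith

section QuadraticForm

variable {D : ℕ} (θ σ : Fin D → ℝ) (t : ℝ)

lemma exp_mul_centered_sum_sq (y : Fin D → ℝ) :
    Real.exp (t * ((∑ j, (θ j + σ j * y j) ^ 2) - ((∑ j, θ j ^ 2) + ∑ j, σ j ^ 2))) =
      ∏ j, Real.exp (t * ((θ j + σ j * y j) ^ 2 - (θ j ^ 2 + σ j ^ 2))) := by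
  rw [← Real.exp_sum, ← mul_sum, sum_sub_distrib, sum_add_distrib]

lemma integrable_exp_mul_centered_sum_sq (ht : ∀ j, 0 < 1 - 2 * t * σ j ^ 2) :
    Integrable (fun y => Real.exp
      (t * ((∑ j, (θ j + σ j * y j) ^ 2) - ((∑ j, θ j ^ 2) + ∑ j, σ j ^ 2)))) (stdGauss D) := by
  simp only [exp_mul_centered_sum_sq]
  exact Integrable.fintype_prod fun j => integrable_exp_sq_gaussianReal (θ j) (σ j) t (ht j)

lemma mgf_centered_sum_sq_le {c : ℝ}
    (h : ∀ j, ∫ y, Real.exp (t * ((θ j + σ j * y) ^ 2 - (θ j ^ 2 + σ j ^ 2)))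
      ∂(gaussianReal 0 1) ≤ Real.exp (c * (σ j ^ 4 + 2 * (σ j ^ 2 * θ j ^ 2)))) :
    mgf (fun y => (∑ j, (θ j + σ j * y j) ^ 2) - ((∑ j, θ j ^ 2) + ∑ j, σ j ^ 2))
      (stdGauss D) t ≤
      Real.exp (c * ((∑ j, σ j ^ 4) + 2 * ∑ j, σ j ^ 2 * θ j ^ 2)) := by
  simp only [mgf, exp_mul_centered_sum_sq, stdGauss]
  rw [integral_fintype_prod_eq_prod
      (fun j y => Real.exp (t * ((θ j + σ j * y) ^ 2 - (θ j ^ 2 + σ j ^ 2)))),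
    mul_sum, ← sum_add_distrib, mul_sum, Real.exp_sum]
  exact prod_le_prod (fun j _ => integral_nonneg fun _ => (Real.exp_pos _).le) fun j _ => h j

end QuadraticForm

/-- Lemma 2: two-sided concentration inequality for the heteroscedastic non-central
chi-square statistic `T̂ = Σ_{j=1}^D Y_j²`, `Y_j = θ_j + σ_j ε_j`, around its expectation
`E[T̂] = Σ θ_j² + Σ σ_j²`, with `Σ = Σ σ_j⁴ + 2 Σ σ_j² θ_j²`. -/
theorem stmt17 (D : ℕ) (hD : 0 < D) (θ σ : Fin D → ℝ) (hσ : ∀ j, 0 < σ j)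
    (x : ℝ) (hx : 0 ≤ x) :
    stdGauss D {y |
        2 * Real.sqrt (((∑ j, σ j ^ 4) + 2 * ∑ j, σ j ^ 2 * θ j ^ 2) * x) +
            2 * (Finset.univ.sup' ⟨⟨0, hD⟩, Finset.mem_univ _⟩ fun j => σ j ^ 2) * x ≤
          (∑ j, (θ j + σ j * y j) ^ 2) - ((∑ j, θ j ^ 2) + ∑ j, σ j ^ 2)} ≤
      ENNReal.ofReal (Real.exp (-x)) ∧
    stdGauss D {y |
        (∑ j, (θ j + σ j * y j) ^ 2) - ((∑ j, θ j ^ 2) + ∑ j, σ j ^ 2) ≤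
          -(2 * Real.sqrt (((∑ j, σ j ^ 4) + 2 * ∑ j, σ j ^ 2 * θ j ^ 2) * x))} ≤
      ENNReal.ofReal (Real.exp (-x)) := by
  have hV : 0 < (∑ j, σ j ^ 4) + 2 * ∑ j, σ j ^ 2 * θ j ^ 2 := by
    have h4 : 0 < ∑ j, σ j ^ 4 :=
      sum_pos (fun j _ => pow_pos (hσ j) 4) ⟨⟨0, hD⟩, mem_univ _⟩
    have h2 : 0 ≤ ∑ j, σ j ^ 2 * θ j ^ 2 := sum_nonneg fun j _ => by positivity
    linarith
  have hM : ∀ j, σ j ^ 2 ≤ univ.sup' ⟨⟨0, hD⟩, mem_univ _⟩ fun j => σ j ^ 2 :=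
    fun j => le_sup' (fun j => σ j ^ 2) (mem_univ j)
  have hM0 := (sq_nonneg _).trans (hM ⟨0, hD⟩)
  have hmgf := fun (t c : ℝ) => mgf_centered_sum_sq_le θ σ t (c := c)
  rw [Real.sqrt_mul hV.le]
  generalize (univ.sup' ⟨⟨0, hD⟩, mem_univ _⟩ fun j => σ j ^ 2) = M at *
  generalize (∑ j, σ j ^ 4) + 2 * ∑ j, σ j ^ 2 * θ j ^ 2 = V at *
  obtain ⟨v, hv, rfl⟩ : ∃ v, 0 < v ∧ v ^ 2 = V := ⟨√V, Real.sqrt_pos.2 hV, Real.sq_sqrt hV.le⟩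
  obtain ⟨r, hr, rfl⟩ : ∃ r, 0 ≤ r ∧ r ^ 2 = x := ⟨√x, Real.sqrt_nonneg _, Real.sq_sqrt hx⟩
  rw [Real.sqrt_sq hv.le, Real.sqrt_sq hr]
  constructor
  · have hw : 0 < v + 2 * M * r := by positivity
    have ht : 0 ≤ r / (v + 2 * M * r) := by positivity
    have hκ : 0 < v / (v + 2 * M * r) := by positivity
    have hle : ∀ j, v / (v + 2 * M * r) ≤ 1 - 2 * (r / (v + 2 * M * r)) * σ j ^ 2 := fun j => by
      have h := mul_le_mul_of_nonneg_left (hM j) ht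
      have : v / (v + 2 * M * r) = 1 - 2 * (r / (v + 2 * M * r) * M) := by
        field_simp
        ring
      linarith
    refine (le_ofReal_iff_toReal_le (measure_ne_top _ _) (Real.exp_pos _).le).2 ?_
    refine (measure_ge_le_exp_mul_mgf _ ht
      (integrable_exp_mul_centered_sum_sq θ σ _ fun j => hκ.trans_le (hle j))).trans ?_
    refine (mul_le_mul_of_nonneg_left (hmgf _ _ fun j =>
      integral_exp_sq_gaussianReal_le_of_nonneg ht hκ (hle j)) (Real.exp_pos _).le).trans_eq ?_
    rw [← Real.exp_add]
    congr 1
    field_simp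
    ring
  · have ht : -(r / v) ≤ 0 := neg_nonpos.2 (by positivity)
    refine (le_ofReal_iff_toReal_le (measure_ne_top _ _) (Real.exp_pos _).le).2 ?_
    refine (measure_le_le_exp_mul_mgf _ ht
      (integrable_exp_mul_centered_sum_sq θ σ _ fun j => ?_)).trans ?_
    · nlinarith [mul_nonneg (neg_nonneg.2 ht) (sq_nonneg (σ j))]
    refine (mul_le_mul_of_nonneg_left (hmgf _ _ fun j =>
      integral_exp_sq_gaussianReal_le_of_nonpos ht) (Real.exp_pos _).le).trans_eq ?_
    rw [← Real.exp_add]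
    congr 1
    field_simp
    ring
end
end
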